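/- arXiv:1706.08747 — 3 statements merged into one kernel-verified Lean document; each statement's English description precedes it below -/
import Mathlib

section
/- There exists a ℚ(q)-algebra homomorphism T_0 : B_c → B_c determined by T_0(B_0) = B_0 and T_0(B_1) = (1/(q²[2]_q c))(B_1B_0² − q[2]_q B_0B_1B_0 + q²B_0²B_1) + B_1; that is, these two images satisfy the defining q-Dolan–Grady relations of B_c. -/
set_option synthInstance.maxHeartbeats 1000000
set_option maxHeartbeats 1000000

noncomputable section

open scoped BigOperators

/-- The field `ℚ(q)` of rational functions. -/
abbrev KK : Type := RatFunc ℚ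

/-- The indeterminate `q ∈ ℚ(q)`. -/
def qq : KK := RatFunc.X

/-- The `q`-Dolan–Grady relations defining the `q`-Onsager algebra `B_c`:
`Σᵢ (−1)ⁱ [3 choose i]_q B₀^{3−i} B₁ B₀^i = −qc(q+q⁻¹)²(B₀B₁ − B₁B₀)` and the
same with `B₀, B₁` interchanged (here `[3 choose 1]_q = [3 choose 2]_q = q² + 1 + q⁻²`). -/
inductive qOnsRel (c : KK) : FreeAlgebra KK (Fin 2) → FreeAlgebra KK (Fin 2) → Prop
  | r0 : qOnsRel c
      (FreeAlgebra.ι KK (0 : Fin 2) ^ 3 * FreeAlgebra.ι KK (1 : Fin 2)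
        - (qq ^ 2 + 1 + (qq⁻¹) ^ 2) • (FreeAlgebra.ι KK (0 : Fin 2) ^ 2 * FreeAlgebra.ι KK (1 : Fin 2) * FreeAlgebra.ι KK (0 : Fin 2))
        + (qq ^ 2 + 1 + (qq⁻¹) ^ 2) • (FreeAlgebra.ι KK (0 : Fin 2) * FreeAlgebra.ι KK (1 : Fin 2) * FreeAlgebra.ι KK (0 : Fin 2) ^ 2)
        - FreeAlgebra.ι KK (1 : Fin 2) * FreeAlgebra.ι KK (0 : Fin 2) ^ 3)
      ((-(qq * c * (qq + qq⁻¹) ^ 2)) •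
        (FreeAlgebra.ι KK (0 : Fin 2) * FreeAlgebra.ι KK (1 : Fin 2) - FreeAlgebra.ι KK (1 : Fin 2) * FreeAlgebra.ι KK (0 : Fin 2)))
  | r1 : qOnsRel c
      (FreeAlgebra.ι KK (1 : Fin 2) ^ 3 * FreeAlgebra.ι KK (0 : Fin 2)
        - (qq ^ 2 + 1 + (qq⁻¹) ^ 2) • (FreeAlgebra.ι KK (1 : Fin 2) ^ 2 * FreeAlgebra.ι KK (0 : Fin 2) * FreeAlgebra.ι KK (1 : Fin 2))
        + (qq ^ 2 + 1 + (qq⁻¹) ^ 2) • (FreeAlgebra.ι KK (1 : Fin 2) * FreeAlgebra.ι KK (0 : Fin 2) * FreeAlgebra.ι KK (1 : Fin 2) ^ 2)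
        - FreeAlgebra.ι KK (0 : Fin 2) * FreeAlgebra.ι KK (1 : Fin 2) ^ 3)
      ((-(qq * c * (qq + qq⁻¹) ^ 2)) •
        (FreeAlgebra.ι KK (1 : Fin 2) * FreeAlgebra.ι KK (0 : Fin 2) - FreeAlgebra.ι KK (0 : Fin 2) * FreeAlgebra.ι KK (1 : Fin 2)))

/-- The `q`-Onsager algebra `B_c`. -/
abbrev QOns (c : KK) : Type := RingQuot (qOnsRel c)

/-- The generator `B₀` of `B_c`. -/
def Bo (c : KK) : QOns c := RingQuot.mkAlgHom KK (qOnsRel c) (FreeAlgebra.ι KK (0 : Fin 2))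

/-- The generator `B₁` of `B_c`. -/
def Bi (c : KK) : QOns c := RingQuot.mkAlgHom KK (qOnsRel c) (FreeAlgebra.ι KK (1 : Fin 2))

/-- `B_δ = −B₀B₁ + q⁻²B₁B₀`. -/
def Bdel (c : KK) : QOns c := -(Bo c * Bi c) + ((qq⁻¹) ^ 2) • (Bi c * Bo c)

/-- `B̃_δ = −B₁B₀ + q⁻²B₀B₁`. -/
def tBdel (c : KK) : QOns c := -(Bi c * Bo c) + ((qq⁻¹) ^ 2) • (Bo c * Bi c)

/-- The formula for `T₀(B₁)`:
`(1/(q²[2]_q c))(B₁B₀² − q[2]_q B₀B₁B₀ + q²B₀²B₁) + B₁`. -/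
def T0B1val (c : KK) : QOns c :=
  (qq ^ 2 * (qq + qq⁻¹) * c)⁻¹ •
    (Bi c * Bo c ^ 2 - (qq * (qq + qq⁻¹)) • (Bo c * Bi c * Bo c) + qq ^ 2 • (Bo c ^ 2 * Bi c))
    + Bi c

/-- The formula for `T₀⁻¹(B₁)`:
`(1/(q²[2]_q c))(B₀²B₁ − q[2]_q B₀B₁B₀ + q²B₁B₀²) + B₁`. -/
def T0invB1val (c : KK) : QOns c :=
  (qq ^ 2 * (qq + qq⁻¹) * c)⁻¹ •
    (Bo c ^ 2 * Bi c - (qq * (qq + qq⁻¹)) • (Bo c * Bi c * Bo c) + qq ^ 2 • (Bi c * Bo c ^ 2))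
    + Bi c

/-- `T₁ = Φ ∘ T₀ ∘ Φ`. -/
def T1def (c : KK) (Φ T0 : QOns c ≃ₐ[KK] QOns c) : QOns c ≃ₐ[KK] QOns c :=
  Φ.trans (T0.trans Φ)

/-- The real root vectors `B_{nδ+α₀} = (T₀Φ)ⁿ(B₀)` for `n ≥ 0`. -/
def Ba0 (c : KK) (Φ T0 : QOns c ≃ₐ[KK] QOns c) (n : ℕ) : QOns c :=
  ((⇑T0 ∘ ⇑Φ)^[n]) (Bo c)

/-- The real root vectors `B_{nδ+α₁} = (T₁⁻¹Φ)ⁿ(B₁)` for `n ≥ 0`. -/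
def Ba1 (c : KK) (Φ T0 : QOns c ≃ₐ[KK] QOns c) (n : ℕ) : QOns c :=
  ((⇑(T1def c Φ T0).symm ∘ ⇑Φ)^[n]) (Bi c)

/-- `B_{kδ+α₁}` for `k ∈ ℤ`, with the convention `B_{kδ+α₁} = B_{(−k−1)δ+α₀}` for `k < 0`. -/
def Ba1Z (c : KK) (Φ T0 : QOns c ≃ₐ[KK] QOns c) (k : ℤ) : QOns c :=
  if 0 ≤ k then Ba1 c Φ T0 k.toNat else Ba0 c Φ T0 (-k - 1).toNat

/-- `B_{kδ+α₀}` for `k ∈ ℤ`, with the convention `B_{kδ+α₀} = B_{(−k−1)δ+α₁}` for `k < 0`. -/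
def Ba0Z (c : KK) (Φ T0 : QOns c ≃ₐ[KK] QOns c) (k : ℤ) : QOns c :=
  if 0 ≤ k then Ba0 c Φ T0 k.toNat else Ba1 c Φ T0 (-k - 1).toNat

/-- `C_m = Σ_{p=0}^{m−2} B_{pδ+α₁} B_{(m−p−2)δ+α₁}` (so `C₀ = C₁ = 0`). -/
def CC (c : KK) (Φ T0 : QOns c ≃ₐ[KK] QOns c) (m : ℕ) : QOns c :=
  ∑ p ∈ Finset.range (m - 1), Ba1 c Φ T0 p * Ba1 c Φ T0 (m - 2 - p)

/-- The imaginary root vectors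
`B_{mδ} = −B₀B_{(m−1)δ+α₁} + q⁻²B_{(m−1)δ+α₁}B₀ + (q⁻²−1)C_m` for `m ≥ 1`. -/
def Bim (c : KK) (Φ T0 : QOns c ≃ₐ[KK] QOns c) (m : ℕ) : QOns c :=
  -(Bo c * Ba1 c Φ T0 (m - 1)) + ((qq⁻¹) ^ 2) • (Ba1 c Φ T0 (m - 1) * Bo c)
    + (((qq⁻¹) ^ 2 - 1)) • CC c Φ T0 m



/-! ### The commutative model: `x^a y x^b y x^d y x^e` corresponds to `X^a Y^b Z^d W^e`. -/

def tpol {R : Type*} [CommRing R] (Q m X Y : R) : R :=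
  Q * (X * X) - (Q + 1) * (X * Y) + Y * Y + m

def ppol {R : Type*} [CommRing R] (Q m X Y : R) : R :=
  Q * (X * (X * X)) - (Q ^ 2 + Q + 1) * (X * (X * Y)) + (Q ^ 2 + Q + 1) * (X * (Y * Y))
    - Q * (Y * (Y * Y)) + (m * (Q + 1)) * X - (m * (Q + 1)) * Y

def cofA {R : Type*} [CommRing R] (Q m X Y Z W : R) : R :=
  Q*Q*(1 + Q*(1 + Q*(1 + Q*1)))*W*W*m
    + Q*(-1 + Q*(-2 + Q*(-3 + Q*(-3 + Q*(-2 + Q*-1)))))*Z*Z*m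
    + Q*(-1 + Q*(-1 + Q*(-2 + Q*(-1 + Q*-1))))*Z*Z*W*W
    + Q*(1 + Q*(2 + Q*(3 + Q*(3 + Q*(2 + Q*1)))))*Z*Z*Z*W
    + Q*Q*(-1 + Q*(-1 + Q*(-2 + Q*(-1 + Q*-1))))*Z*Z*Z*Z
    + Q*Q*Q*(-1 + Q*(-1 + Q*-1))*Y*W*m
    + Q*(1 + Q*(3 + Q*(5 + Q*(6 + Q*(4 + Q*2)))))*Y*Z*m
    + Q*(1 + Q*(2 + Q*(3 + Q*(3 + Q*(2 + Q*1)))))*Y*Z*W*W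
    + Q*(-1 + Q*(-3 + Q*(-5 + Q*(-6 + Q*(-5 + Q*(-3 + Q*-1))))))*Y*Z*Z*W
    + Q*Q*(1 + Q*(2 + Q*(3 + Q*(3 + Q*(2 + Q*1)))))*Y*Z*Z*Z
    + Q*Q*(-1 + Q*(-2 + Q*(-3 + Q*(-2 + Q*-1))))*Y*Y*m
    + Q*Q*(-1 + Q*(-1 + Q*(-2 + Q*(-1 + Q*-1))))*Y*Y*W*W
    + Q*Q*(1 + Q*(2 + Q*(3 + Q*(3 + Q*(2 + Q*1)))))*Y*Y*Z*W
    + Q*Q*Q*(-1 + Q*(-1 + Q*(-2 + Q*(-1 + Q*-1))))*Y*Y*Z*Z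
    + Q*Q*(-1 + Q*(-1 + Q*(-2 + Q*-1)))*X*W*m
    + Q*Q*Q*(1 + Q*(1 + Q*1))*X*Z*m
    + Q*Q*Q*Q*1*X*X*m

def cofB {R : Type*} [CommRing R] (Q m X Y Z W : R) : R :=
  Q*Q*(1 + Q*(1 + Q*(1 + Q*1)))*W*W*m
    + Q*(-1 + Q*(-2 + Q*(-4 + Q*(-4 + Q*(-3 + Q*-1)))))*Z*W*m
    + Q*Q*(1 + Q*(2 + Q*(3 + Q*(2 + Q*1))))*Z*Z*m
    + (-1 + Q*(-1 + Q*(-2 + Q*(-2 + Q*(-2 + Q*-1)))))*Y*W*m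
    + Q*(1 + Q*(1 + Q*(2 + Q*(1 + Q*1))))*Y*Z*m
    + (1 + Q*(2 + Q*(3 + Q*(2 + Q*1))))*Y*Y*m
    + (1 + Q*(2 + Q*(3 + Q*(3 + Q*(2 + Q*1)))))*Y*Y*W*W
    + (-1 + Q*(-3 + Q*(-5 + Q*(-6 + Q*(-5 + Q*(-3 + Q*-1))))))*Y*Y*Z*W
    + Q*(1 + Q*(2 + Q*(3 + Q*(3 + Q*(2 + Q*1)))))*Y*Y*Z*Z
    + (1 + Q*(2 + Q*(3 + Q*(4 + Q*(3 + Q*(2 + Q*1))))))*X*W*m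
    + Q*(-1 + Q*(-2 + Q*(-2 + Q*(-2 + Q*(-1 + Q*-1)))))*X*Z*m
    + (-1 + Q*(-3 + Q*(-4 + Q*(-4 + Q*(-2 + Q*-1)))))*X*Y*m
    + (-1 + Q*(-3 + Q*(-5 + Q*(-6 + Q*(-5 + Q*(-3 + Q*-1))))))*X*Y*W*W
    + (1 + Q*(4 + Q*(8 + Q*(11 + Q*(11 + Q*(8 + Q*(4 + Q*1)))))))*X*Y*Z*W
    + Q*(-1 + Q*(-3 + Q*(-5 + Q*(-6 + Q*(-5 + Q*(-3 + Q*-1))))))*X*Y*Z*Z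
    + Q*(1 + Q*(1 + Q*(1 + Q*1)))*X*X*m
    + Q*(1 + Q*(2 + Q*(3 + Q*(3 + Q*(2 + Q*1)))))*X*X*W*W
    + Q*(-1 + Q*(-3 + Q*(-5 + Q*(-6 + Q*(-5 + Q*(-3 + Q*-1))))))*X*X*Z*W
    + Q*Q*(1 + Q*(2 + Q*(3 + Q*(3 + Q*(2 + Q*1)))))*X*X*Z*Z

def cofC {R : Type*} [CommRing R] (Q m X Y Z W : R) : R :=
  Q*Q*1*W*W*m
    + (-1 + Q*(-2 + Q*(-3 + Q*(-2 + Q*-1))))*Z*Z*m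
    + Q*(1 + Q*(1 + Q*1))*Y*W*m
    + (2 + Q*(4 + Q*(6 + Q*(5 + Q*(3 + Q*1)))))*Y*Z*m
    + (-1 + Q*(-2 + Q*(-3 + Q*(-3 + Q*(-2 + Q*-1)))))*Y*Y*m
    + (-1 + Q*(-1 + Q*(-2 + Q*(-1 + Q*-1))))*Y*Y*Z*Z
    + (1 + Q*(2 + Q*(3 + Q*(3 + Q*(2 + Q*1)))))*Y*Y*Y*Z
    + Q*(-1 + Q*(-1 + Q*(-2 + Q*(-1 + Q*-1))))*Y*Y*Y*Y
    + Q*(-1 + Q*(-2 + Q*(-1 + Q*-1)))*X*W*m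
    + Q*(-1 + Q*(-1 + Q*-1))*X*Z*m
    + (1 + Q*(2 + Q*(3 + Q*(3 + Q*(2 + Q*1)))))*X*Y*Z*Z
    + (-1 + Q*(-3 + Q*(-5 + Q*(-6 + Q*(-5 + Q*(-3 + Q*-1))))))*X*Y*Y*Z
    + Q*(1 + Q*(2 + Q*(3 + Q*(3 + Q*(2 + Q*1)))))*X*Y*Y*Y
    + Q*(1 + Q*(1 + Q*(1 + Q*1)))*X*X*m
    + Q*(-1 + Q*(-1 + Q*(-2 + Q*(-1 + Q*-1))))*X*X*Z*Z
    + Q*(1 + Q*(2 + Q*(3 + Q*(3 + Q*(2 + Q*1)))))*X*X*Y*Z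
    + Q*Q*(-1 + Q*(-1 + Q*(-2 + Q*(-1 + Q*-1))))*X*X*Y*Y

theorem qons_ident {R : Type*} [CommRing R] (X Y Z W Q m : R) :
    (Q ^ 2 + 1) * (Q ^ 2 + Q + 1) * (tpol Q m X Y * (tpol Q m Y Z * (tpol Q m Z W
        * (Q * (W - X) + (Q ^ 2 + Q + 1) * (Y - Z)))))
      = (Q ^ 2 + 1) * (Q ^ 2 + Q + 1) * m ^ 2
          * (tpol Q m X W * (Q * (W - X) + (Q ^ 2 + Q + 1) * (Y - Z)))
        + m * Q * (ppol Q m X W * ((Q ^ 2 * X - W) * (Q * (W - X) + (Q ^ 2 + Q + 1) * (Y - Z))))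
        + ppol Q m X Y * cofA Q m X Y Z W
        + ppol Q m Y Z * cofB Q m X Y Z W
        + ppol Q m Z W * cofC Q m X Y Z W := by
  unfold tpol ppol cofA cofB cofC
  ring

section generic

variable {F A : Type*} [Field F] [Ring A] [Algebra F A]

def tx (Q m : F) (x u : A) : A :=
  Q • (x * (x * u)) - (Q + 1) • (x * (u * x)) + u * x * x + m • u

def px (Q m : F) (x u : A) : A :=
  Q • (x * (x * (x * u))) - (Q ^ 2 + Q + 1) • (x * (x * (u * x)))
    + (Q ^ 2 + Q + 1) • (x * (u * x * x)) - Q • (u * x * x * x)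
    + (m * (Q + 1)) • (x * u) - (m * (Q + 1)) • (u * x)

/-- The linear map `X^a Y^b Z^d W^e ↦ x^a u x^b v x^d w x^e`. -/
def Psi (F : Type*) {A : Type*} [Field F] [Ring A] [Algebra F A] (x u v w : A) :
    MvPolynomial (Fin 4) F →ₗ[F] A :=
  (MvPolynomial.basisMonomials (Fin 4) F).constr F
    (fun e => x ^ e 0 * u * x ^ e 1 * v * x ^ e 2 * w * x ^ e 3)

theorem Psi_monomial (x u v w : A) (e : Fin 4 →₀ ℕ) (a : F) :
    Psi F x u v w (MvPolynomial.monomial e a)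
      = a • (x ^ e 0 * u * x ^ e 1 * v * x ^ e 2 * w * x ^ e 3) := by
  have h : MvPolynomial.monomial e a = a • MvPolynomial.basisMonomials (Fin 4) F e := by
    simp [MvPolynomial.smul_monomial]
  rw [h, map_smul, Psi, Module.Basis.constr_basis]

theorem Psi_C (x u v w : A) (k : F) (f : MvPolynomial (Fin 4) F) :
    Psi F x u v w (MvPolynomial.C k * f) = k • Psi F x u v w f := by
  rw [MvPolynomial.C_mul', map_smul]

theorem X_mul_monomial (i : Fin 4) (e : Fin 4 →₀ ℕ) (a : F) :
    (MvPolynomial.X i : MvPolynomial (Fin 4) F) * MvPolynomial.monomial e a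
      = MvPolynomial.monomial (Finsupp.single i 1 + e) a := by
  rw [MvPolynomial.X, MvPolynomial.monomial_mul, one_mul]

theorem Psi_l (x u v w : A) (f : MvPolynomial (Fin 4) F) :
    Psi F x u v w (MvPolynomial.X 0 * f) = x * Psi F x u v w f := by
  induction f using MvPolynomial.induction_on' with
  | monomial e a =>
    rw [X_mul_monomial, Psi_monomial, Psi_monomial]
    simp [pow_add, mul_assoc]
  | add p q hp hq => rw [mul_add, map_add, map_add, hp, hq, mul_add]

theorem Psi_r (x u v w : A) (f : MvPolynomial (Fin 4) F) :
    Psi F x u v w (MvPolynomial.X 3 * f) = Psi F x u v w f * x := by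
  induction f using MvPolynomial.induction_on' with
  | monomial e a =>
    rw [X_mul_monomial, Psi_monomial, Psi_monomial]
    simp [pow_succ, add_comm 1, mul_assoc]
  | add p q hp hq => rw [mul_add, map_add, map_add, hp, hq, add_mul]

theorem Psi_ul (x u v w : A) (f : MvPolynomial (Fin 4) F) :
    Psi F x (x * u) v w f = Psi F x u v w (MvPolynomial.X 0 * f) := by
  induction f using MvPolynomial.induction_on' with
  | monomial e a =>
    rw [X_mul_monomial, Psi_monomial, Psi_monomial]
    simp [pow_succ, add_comm 1, mul_assoc]
  | add p q hp hq => rw [mul_add, map_add, map_add, hp, hq]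

theorem Psi_ur (x u v w : A) (f : MvPolynomial (Fin 4) F) :
    Psi F x (u * x) v w f = Psi F x u v w (MvPolynomial.X 1 * f) := by
  induction f using MvPolynomial.induction_on' with
  | monomial e a =>
    rw [X_mul_monomial, Psi_monomial, Psi_monomial]
    simp [pow_succ', add_comm 1, mul_assoc]
  | add p q hp hq => rw [mul_add, map_add, map_add, hp, hq]

theorem Psi_vl (x u v w : A) (f : MvPolynomial (Fin 4) F) :
    Psi F x u (x * v) w f = Psi F x u v w (MvPolynomial.X 1 * f) := by
  induction f using MvPolynomial.induction_on' with
  | monomial e a =>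
    rw [X_mul_monomial, Psi_monomial, Psi_monomial]
    simp [pow_succ, add_comm 1, mul_assoc]
  | add p q hp hq => rw [mul_add, map_add, map_add, hp, hq]

theorem Psi_vr (x u v w : A) (f : MvPolynomial (Fin 4) F) :
    Psi F x u (v * x) w f = Psi F x u v w (MvPolynomial.X 2 * f) := by
  induction f using MvPolynomial.induction_on' with
  | monomial e a =>
    rw [X_mul_monomial, Psi_monomial, Psi_monomial]
    simp [pow_succ', add_comm 1, mul_assoc]
  | add p q hp hq => rw [mul_add, map_add, map_add, hp, hq]

theorem Psi_wl (x u v w : A) (f : MvPolynomial (Fin 4) F) :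
    Psi F x u v (x * w) f = Psi F x u v w (MvPolynomial.X 2 * f) := by
  induction f using MvPolynomial.induction_on' with
  | monomial e a =>
    rw [X_mul_monomial, Psi_monomial, Psi_monomial]
    simp [pow_succ, add_comm 1, mul_assoc]
  | add p q hp hq => rw [mul_add, map_add, map_add, hp, hq]

theorem Psi_wr (x u v w : A) (f : MvPolynomial (Fin 4) F) :
    Psi F x u v (w * x) f = Psi F x u v w (MvPolynomial.X 3 * f) := by
  induction f using MvPolynomial.induction_on' with
  | monomial e a =>
    rw [X_mul_monomial, Psi_monomial, Psi_monomial]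
    simp [pow_succ', add_comm 1, mul_assoc]
  | add p q hp hq => rw [mul_add, map_add, map_add, hp, hq]

/-- `Psi` is linear in each of its three slots. -/
theorem Psi_uadd (x u u' v w : A) (k : F) (f : MvPolynomial (Fin 4) F) :
    Psi F x (u + k • u') v w f = Psi F x u v w f + k • Psi F x u' v w f := by
  induction f using MvPolynomial.induction_on' with
  | monomial e a =>
    simp only [Psi_monomial, mul_add, add_mul, smul_add, mul_smul_comm, smul_mul_assoc,
      smul_comm k a]
  | add p q hp hq => rw [map_add, map_add, map_add, hp, hq, smul_add]; abel

theorem Psi_vadd (x u v v' w : A) (k : F) (f : MvPolynomial (Fin 4) F) :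
    Psi F x u (v + k • v') w f = Psi F x u v w f + k • Psi F x u v' w f := by
  induction f using MvPolynomial.induction_on' with
  | monomial e a =>
    simp only [Psi_monomial, mul_add, add_mul, smul_add, mul_smul_comm, smul_mul_assoc,
      smul_comm k a]
  | add p q hp hq => rw [map_add, map_add, map_add, hp, hq, smul_add]; abel

theorem Psi_wadd (x u v w w' : A) (k : F) (f : MvPolynomial (Fin 4) F) :
    Psi F x u v (w + k • w') f = Psi F x u v w f + k • Psi F x u v w' f := by
  induction f using MvPolynomial.induction_on' with
  | monomial e a =>
    simp only [Psi_monomial, mul_add, add_mul, smul_add, mul_smul_comm, smul_mul_assoc,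
      smul_comm k a]
  | add p q hp hq => rw [map_add, map_add, map_add, hp, hq, smul_add]; abel

theorem Psi_zero (x u v w : A) (f : MvPolynomial (Fin 4) F) :
    Psi F x 0 v w f = 0 ∧ Psi F x u 0 w f = 0 ∧ Psi F x u v 0 f = 0 := by
  induction f using MvPolynomial.induction_on' with
  | monomial e a => simp [Psi_monomial]
  | add p q hp hq => simp [map_add, hp, hq]

theorem tx_eq (Q m : F) (x u : A) : tx Q m x u
    = 0 + Q • (x * (x * u)) + (-(Q + 1)) • (x * (u * x)) + (1 : F) • (u * x * x) + m • u := by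
  unfold tx; module

theorem px_eq (Q m : F) (x u : A) : px Q m x u
    = 0 + Q • (x * (x * (x * u))) + (-(Q ^ 2 + Q + 1)) • (x * (x * (u * x)))
    + (Q ^ 2 + Q + 1) • (x * (u * x * x)) + (-Q) • (u * x * x * x)
    + (m * (Q + 1)) • (x * u) + (-(m * (Q + 1))) • (u * x) := by
  unfold px; module

open MvPolynomial in
theorem Psi_tu (Q m : F) (x u v w : A) (f : MvPolynomial (Fin 4) F) :
    Psi F x (tx Q m x u) v w f = Psi F x u v w (tpol (C Q) (C m) (X 0) (X 1) * f) := by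
  rw [tx_eq]
  simp only [Psi_uadd, Psi_ul, Psi_ur, (Psi_zero x u v w f).1]
  simp only [← Psi_C, ← map_add, zero_add]
  congr 1
  simp only [tpol, map_neg, map_add, map_one]
  ring

open MvPolynomial in
theorem Psi_tv (Q m : F) (x u v w : A) (f : MvPolynomial (Fin 4) F) :
    Psi F x u (tx Q m x v) w f = Psi F x u v w (tpol (C Q) (C m) (X 1) (X 2) * f) := by
  rw [tx_eq]
  simp only [Psi_vadd, Psi_vl, Psi_vr, (Psi_zero x u v w f).2.1]
  simp only [← Psi_C, ← map_add, zero_add]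
  congr 1
  simp only [tpol, map_neg, map_add, map_one]
  ring

open MvPolynomial in
theorem Psi_tw (Q m : F) (x u v w : A) (f : MvPolynomial (Fin 4) F) :
    Psi F x u v (tx Q m x w) f = Psi F x u v w (tpol (C Q) (C m) (X 2) (X 3) * f) := by
  rw [tx_eq]
  simp only [Psi_wadd, Psi_wl, Psi_wr, (Psi_zero x u v w f).2.2]
  simp only [← Psi_C, ← map_add, zero_add]
  congr 1
  simp only [tpol, map_neg, map_add, map_one]
  ring

open MvPolynomial in
theorem Psi_pu (Q m : F) (x u v w : A) (f : MvPolynomial (Fin 4) F) (h : px Q m x u = 0) :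
    Psi F x u v w (ppol (C Q) (C m) (X 0) (X 1) * f) = 0 := by
  rw [← (Psi_zero x u v w f).1, ← h, px_eq]
  simp only [Psi_uadd, Psi_ul, Psi_ur, (Psi_zero x u v w f).1]
  simp only [← Psi_C, ← map_add, zero_add]
  congr 1
  simp only [ppol, map_neg, map_add, map_one, map_mul, map_pow]
  ring

open MvPolynomial in
theorem Psi_pv (Q m : F) (x u v w : A) (f : MvPolynomial (Fin 4) F) (h : px Q m x v = 0) :
    Psi F x u v w (ppol (C Q) (C m) (X 1) (X 2) * f) = 0 := by
  rw [← (Psi_zero x u v w f).2.1, ← h, px_eq]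
  simp only [Psi_vadd, Psi_vl, Psi_vr, (Psi_zero x u v w f).2.1]
  simp only [← Psi_C, ← map_add, zero_add]
  congr 1
  simp only [ppol, map_neg, map_add, map_one, map_mul, map_pow]
  ring

open MvPolynomial in
theorem Psi_pw (Q m : F) (x u v w : A) (f : MvPolynomial (Fin 4) F) (h : px Q m x w = 0) :
    Psi F x u v w (ppol (C Q) (C m) (X 2) (X 3) * f) = 0 := by
  rw [← (Psi_zero x u v w f).2.2, ← h, px_eq]
  simp only [Psi_wadd, Psi_wl, Psi_wr, (Psi_zero x u v w f).2.2]
  simp only [← Psi_C, ← map_add, zero_add]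
  congr 1
  simp only [ppol, map_neg, map_add, map_one, map_mul, map_pow]
  ring

open MvPolynomial in
theorem Psi_tout (Q m : F) (x u v w : A) (f : MvPolynomial (Fin 4) F) :
    Psi F x u v w (tpol (C Q) (C m) (X 0) (X 3) * f) = tx Q m x (Psi F x u v w f) := by
  rw [tx_eq]
  simp only [← Psi_l, ← Psi_r]
  simp only [← Psi_C, ← map_add, zero_add]
  congr 1
  simp only [tpol, map_neg, map_add, map_one]
  ring

open MvPolynomial in
theorem Psi_pout (Q m : F) (x u v w : A) (f : MvPolynomial (Fin 4) F) :
    Psi F x u v w (ppol (C Q) (C m) (X 0) (X 3) * f) = px Q m x (Psi F x u v w f) := by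
  rw [px_eq]
  simp only [← Psi_l, ← Psi_r]
  simp only [← Psi_C, ← map_add, zero_add]
  congr 1
  simp only [ppol, map_neg, map_add, map_one, map_mul, map_pow]
  ring

/-- The left-hand side of the second relation (times `Q`), in the commutative model. -/
def Ppol (Q : F) : MvPolynomial (Fin 4) F :=
  MvPolynomial.C Q * (MvPolynomial.X 3 - MvPolynomial.X 0)
    + (MvPolynomial.C Q ^ 2 + MvPolynomial.C Q + 1) * (MvPolynomial.X 1 - MvPolynomial.X 2)

theorem Psi_P (Q : F) (x u : A) : Psi F x u u u (Ppol Q) =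
    Q • (u * u * u * x) - (Q ^ 2 + Q + 1) • (u * u * x * u)
      + (Q ^ 2 + Q + 1) • (u * x * u * u) - Q • (x * u * u * u) := by
  have h : Ppol Q = MvPolynomial.monomial (Finsupp.single 3 1) Q
      - MvPolynomial.monomial (Finsupp.single 2 1) (Q ^ 2 + Q + 1)
      + MvPolynomial.monomial (Finsupp.single 1 1) (Q ^ 2 + Q + 1)
      - MvPolynomial.monomial (Finsupp.single 0 1) Q := by
    simp only [← MvPolynomial.C_mul_X_eq_monomial, Ppol, map_add, map_pow, map_one]
    ring
  rw [h]
  simp [Psi_monomial]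
  module

/-- The second relation is transported by `T₀` (denominators cleared). -/
theorem key (Q m K : F) (x y : A) (hD : (Q ^ 2 + 1) * (Q ^ 2 + Q + 1) ≠ 0)
    (h0 : px Q m x y = 0)
    (h1 : Psi F x y y y (Ppol Q) = K • (y * x - x * y)) :
    Psi F x (tx Q m x y) (tx Q m x y) (tx Q m x y) (Ppol Q)
      = (K * m ^ 2) • (tx Q m x y * x - x * tx Q m x y) := by
  have hid := qons_ident (MvPolynomial.X 0 : MvPolynomial (Fin 4) F) (MvPolynomial.X 1)
    (MvPolynomial.X 2) (MvPolynomial.X 3) (MvPolynomial.C Q) (MvPolynomial.C m)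
  rw [← Ppol] at hid
  have hC : (MvPolynomial.C Q ^ 2 + 1) * (MvPolynomial.C Q ^ 2 + MvPolynomial.C Q + 1)
      = (MvPolynomial.C ((Q ^ 2 + 1) * (Q ^ 2 + Q + 1)) : MvPolynomial (Fin 4) F) := by
    simp only [map_add, map_mul, map_pow, map_one]
  have hid2 := congrArg (Psi F x y y y) hid
  rw [hC, ← map_pow, ← map_mul, ← map_mul, map_add, map_add, map_add, map_add,
    Psi_pu _ _ _ _ _ _ _ h0, Psi_pv _ _ _ _ _ _ _ h0, Psi_pw _ _ _ _ _ _ _ h0,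
    Psi_C, Psi_C, Psi_C, Psi_tout, Psi_pout, ← Psi_tu, ← Psi_tv, ← Psi_tw] at hid2
  have hh : Psi F x y y y ((MvPolynomial.C Q ^ 2 * MvPolynomial.X 0 - MvPolynomial.X 3) * Ppol Q)
      = Q ^ 2 • (x * Psi F x y y y (Ppol Q)) - Psi F x y y y (Ppol Q) * x := by
    rw [sub_mul, map_sub, ← map_pow, mul_assoc, Psi_C, Psi_l, Psi_r]
  have hp : px Q m x (Q ^ 2 • (x * Psi F x y y y (Ppol Q)) - Psi F x y y y (Ppol Q) * x)
      = Q ^ 2 • (x * (K • (px Q m x y * x - x * px Q m x y)))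
        - (K • (px Q m x y * x - x * px Q m x y)) * x := by
    rw [h1]
    simp only [px, mul_sub, sub_mul, mul_add, add_mul, mul_smul_comm, smul_mul_assoc, mul_assoc,
      smul_sub, smul_add, smul_smul]
    module
  have ht : tx Q m x (Psi F x y y y (Ppol Q)) = K • (tx Q m x y * x - x * tx Q m x y) := by
    rw [h1]
    simp only [tx, mul_sub, sub_mul, mul_add, add_mul, mul_smul_comm, smul_mul_assoc, mul_assoc,
      smul_sub, smul_add, smul_smul]
    module
  rw [hh, hp, h0, ht] at hid2
  simp only [zero_mul, mul_zero, sub_zero, smul_zero, add_zero] at hid2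
  have := congrArg (fun z => ((Q ^ 2 + 1) * (Q ^ 2 + Q + 1))⁻¹ • z) hid2
  simp only [smul_smul] at this
  rw [inv_mul_cancel₀ hD, one_smul] at this
  rw [this]
  congr 1
  rw [mul_assoc ((Q ^ 2 + 1) * (Q ^ 2 + Q + 1)), inv_mul_cancel_left₀ hD, mul_comm]

theorem px_tx (Q m : F) (x y : A) : px Q m x (tx Q m x y) = tx Q m x (px Q m x y) := by
  simp only [tx, px, mul_sub, sub_mul, mul_add, add_mul, mul_smul_comm, smul_mul_assoc, mul_assoc,
    smul_sub, smul_add, smul_smul]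
  module

theorem px_iff (q c : F) (hq : q ≠ 0) (x y : A) :
    x ^ 3 * y - (q ^ 2 + 1 + (q⁻¹) ^ 2) • (x ^ 2 * y * x)
      + (q ^ 2 + 1 + (q⁻¹) ^ 2) • (x * y * x ^ 2) - y * x ^ 3
      = (-(q * c * (q + q⁻¹) ^ 2)) • (x * y - y * x)
    ↔ px (q ^ 2) (q ^ 2 * (q + q⁻¹) * c) x y = 0 := by
  have h : px (q ^ 2) (q ^ 2 * (q + q⁻¹) * c) x y = q ^ 2 •
      (x ^ 3 * y - (q ^ 2 + 1 + (q⁻¹) ^ 2) • (x ^ 2 * y * x)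
      + (q ^ 2 + 1 + (q⁻¹) ^ 2) • (x * y * x ^ 2) - y * x ^ 3
      - (-(q * c * (q + q⁻¹) ^ 2)) • (x * y - y * x)) := by
    simp only [px, pow_succ x, pow_zero, one_mul, mul_assoc]
    match_scalars <;> field_simp
  rw [h, smul_eq_zero_iff_right (pow_ne_zero 2 hq), sub_eq_zero]

theorem Psi_iff (q c : F) (hq : q ≠ 0) (x y : A) :
    y ^ 3 * x - (q ^ 2 + 1 + (q⁻¹) ^ 2) • (y ^ 2 * x * y)
      + (q ^ 2 + 1 + (q⁻¹) ^ 2) • (y * x * y ^ 2) - x * y ^ 3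
      = (-(q * c * (q + q⁻¹) ^ 2)) • (y * x - x * y)
    ↔ Psi F x y y y (Ppol (q ^ 2)) = (-(q ^ 3 * c * (q + q⁻¹) ^ 2)) • (y * x - x * y) := by
  have h : Psi F x y y y (Ppol (q ^ 2)) - (-(q ^ 3 * c * (q + q⁻¹) ^ 2)) • (y * x - x * y) = q ^ 2 •
      (y ^ 3 * x - (q ^ 2 + 1 + (q⁻¹) ^ 2) • (y ^ 2 * x * y)
      + (q ^ 2 + 1 + (q⁻¹) ^ 2) • (y * x * y ^ 2) - x * y ^ 3
      - (-(q * c * (q + q⁻¹) ^ 2)) • (y * x - x * y)) := by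
    rw [Psi_P]
    simp only [pow_succ y, pow_zero, one_mul, mul_assoc]
    match_scalars <;> field_simp
  rw [← sub_eq_zero, ← smul_eq_zero_iff_right (pow_ne_zero 2 hq), ← h, sub_eq_zero]

theorem Psi_smul3 (x y : A) (k : F) (f : MvPolynomial (Fin 4) F) :
    Psi F x (k • y) (k • y) (k • y) f = k ^ 3 • Psi F x y y y f := by
  induction f using MvPolynomial.induction_on' with
  | monomial e a =>
    simp only [Psi_monomial, mul_smul_comm, smul_mul_assoc, smul_smul]
    congr 1
    ring
  | add p q hp hq => rw [map_add, map_add, hp, hq, smul_add]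

theorem px_smul (Q m k : F) (x y : A) : px Q m x (k • y) = k • px Q m x y := by
  simp only [px, mul_smul_comm, smul_mul_assoc]
  module

theorem generic_main (q c : F) (hq : q ≠ 0) (hm : q ^ 2 * (q + q⁻¹) * c ≠ 0)
    (hD : ((q ^ 2) ^ 2 + 1) * ((q ^ 2) ^ 2 + q ^ 2 + 1) ≠ 0) (x y z : A)
    (hz : z = (q ^ 2 * (q + q⁻¹) * c)⁻¹ •
      (y * x ^ 2 - (q * (q + q⁻¹)) • (x * y * x) + q ^ 2 • (x ^ 2 * y)) + y)
    (h0 : x ^ 3 * y - (q ^ 2 + 1 + (q⁻¹) ^ 2) • (x ^ 2 * y * x)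
      + (q ^ 2 + 1 + (q⁻¹) ^ 2) • (x * y * x ^ 2) - y * x ^ 3
      = (-(q * c * (q + q⁻¹) ^ 2)) • (x * y - y * x))
    (h1 : y ^ 3 * x - (q ^ 2 + 1 + (q⁻¹) ^ 2) • (y ^ 2 * x * y)
      + (q ^ 2 + 1 + (q⁻¹) ^ 2) • (y * x * y ^ 2) - x * y ^ 3
      = (-(q * c * (q + q⁻¹) ^ 2)) • (y * x - x * y)) :
    (x ^ 3 * z - (q ^ 2 + 1 + (q⁻¹) ^ 2) • (x ^ 2 * z * x)
      + (q ^ 2 + 1 + (q⁻¹) ^ 2) • (x * z * x ^ 2) - z * x ^ 3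
      = (-(q * c * (q + q⁻¹) ^ 2)) • (x * z - z * x)) ∧
    (z ^ 3 * x - (q ^ 2 + 1 + (q⁻¹) ^ 2) • (z ^ 2 * x * z)
      + (q ^ 2 + 1 + (q⁻¹) ^ 2) • (z * x * z ^ 2) - x * z ^ 3
      = (-(q * c * (q + q⁻¹) ^ 2)) • (z * x - x * z)) := by
  rw [px_iff q c hq] at h0 ⊢
  rw [Psi_iff q c hq] at h1 ⊢
  have hqq : q * (q + q⁻¹) = q ^ 2 + 1 := by field_simp
  have hz' : z = (q ^ 2 * (q + q⁻¹) * c)⁻¹ • tx (q ^ 2) (q ^ 2 * (q + q⁻¹) * c) x y := by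
    rw [hz, tx, hqq, smul_add _ _ ((q ^ 2 * (q + q⁻¹) * c) • y), smul_smul, inv_mul_cancel₀ hm,
      one_smul]
    congr 2
    simp only [pow_succ x, pow_zero, one_mul, mul_assoc]
    abel
  generalize q ^ 2 * (q + q⁻¹) * c = m at *
  constructor
  · rw [hz', px_smul, px_tx, h0]
    simp [tx]
  · rw [hz', Psi_smul3, key _ _ _ _ _ hD h0 h1, mul_smul_comm, smul_mul_assoc, ← smul_sub,
      smul_smul, smul_smul]
    congr 1
    field_simp

end generic

theorem ratfunc_ne (p : Polynomial ℚ) (h : p.eval 1 ≠ 0) : algebraMap (Polynomial ℚ) KK p ≠ 0 := by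
  intro h'
  rw [map_eq_zero_iff _ (RatFunc.algebraMap_injective ℚ)] at h'
  simp [h'] at h

theorem qq_eq : qq = algebraMap (Polynomial ℚ) KK Polynomial.X := by
  rw [qq, RatFunc.algebraMap_X]

theorem qOns_images (c : KK) (hc : c ≠ 0) :
    (Bo c ^ 3 * T0B1val c - (qq ^ 2 + 1 + (qq⁻¹) ^ 2) • (Bo c ^ 2 * T0B1val c * Bo c)
      + (qq ^ 2 + 1 + (qq⁻¹) ^ 2) • (Bo c * T0B1val c * Bo c ^ 2) - T0B1val c * Bo c ^ 3
      = (-(qq * c * (qq + qq⁻¹) ^ 2)) • (Bo c * T0B1val c - T0B1val c * Bo c)) ∧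
    (T0B1val c ^ 3 * Bo c - (qq ^ 2 + 1 + (qq⁻¹) ^ 2) • (T0B1val c ^ 2 * Bo c * T0B1val c)
      + (qq ^ 2 + 1 + (qq⁻¹) ^ 2) • (T0B1val c * Bo c * T0B1val c ^ 2) - Bo c * T0B1val c ^ 3
      = (-(qq * c * (qq + qq⁻¹) ^ 2)) • (T0B1val c * Bo c - Bo c * T0B1val c)) := by
  have hq : qq ≠ 0 := by
    rw [qq_eq]; exact ratfunc_ne _ (by simp)
  have h2 : qq ^ 2 + 1 ≠ 0 := by
    have := ratfunc_ne (Polynomial.X ^ 2 + 1) (by norm_num)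
    simpa only [map_add, map_pow, map_one, ← qq_eq] using this
  have hD : ((qq ^ 2) ^ 2 + 1) * ((qq ^ 2) ^ 2 + qq ^ 2 + 1) ≠ 0 := by
    have := ratfunc_ne (((Polynomial.X ^ 2) ^ 2 + 1)
      * ((Polynomial.X ^ 2) ^ 2 + Polynomial.X ^ 2 + 1)) (by norm_num)
    simpa only [map_add, map_mul, map_pow, map_one, ← qq_eq] using this
  have hqi : qq + qq⁻¹ ≠ 0 := by
    have : qq * (qq + qq⁻¹) = qq ^ 2 + 1 := by
      rw [mul_add, mul_inv_cancel₀ hq, sq]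
    intro h
    rw [h, mul_zero] at this
    exact h2 this.symm
  refine generic_main qq c hq (mul_ne_zero (mul_ne_zero (pow_ne_zero 2 hq) hqi) hc) hD
    (Bo c) (Bi c) (T0B1val c) rfl ?_ ?_
  · have h := RingQuot.mkAlgHom_rel KK (qOnsRel.r0 (c := c))
    simp only [map_add, map_sub, map_mul, map_pow, map_smul] at h
    exact h
  · have h := RingQuot.mkAlgHom_rel KK (qOnsRel.r1 (c := c))
    simp only [map_add, map_sub, map_mul, map_pow, map_smul] at h
    exact h

/-- There exists an algebra homomorphism `T₀ : B_c → B_c` with `T₀(B₀) = B₀` and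
`T₀(B₁) = (1/(q²[2]_q c))(B₁B₀² − q[2]_q B₀B₁B₀ + q²B₀²B₁) + B₁`. -/
theorem stmt4 (c : KK) (hc : c ≠ 0) :
    ∃ T0 : QOns c →ₐ[KK] QOns c, T0 (Bo c) = Bo c ∧ T0 (Bi c) = T0B1val c := by
  obtain ⟨h0, h1⟩ := qOns_images c hc
  refine ⟨RingQuot.liftAlgHom KK ⟨FreeAlgebra.lift KK ![Bo c, T0B1val c], ?_⟩, ?_, ?_⟩
  · intro a b hab
    cases hab with
    | r0 =>
      simp only [map_add, map_sub, map_mul, map_pow, map_smul, FreeAlgebra.lift_ι_apply,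
        Matrix.cons_val_zero, Matrix.cons_val_one]
      exact h0
    | r1 =>
      simp only [map_add, map_sub, map_mul, map_pow, map_smul, FreeAlgebra.lift_ι_apply,
        Matrix.cons_val_zero, Matrix.cons_val_one]
      exact h1
  · change RingQuot.liftAlgHom KK _ (RingQuot.mkAlgHom KK (qOnsRel c) (FreeAlgebra.ι KK (0 : Fin 2))) = _
    rw [RingQuot.liftAlgHom_mkAlgHom_apply]
    simp
  · change RingQuot.liftAlgHom KK _ (RingQuot.mkAlgHom KK (qOnsRel c) (FreeAlgebra.ι KK (1 : Fin 2))) = _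
    rw [RingQuot.liftAlgHom_mkAlgHom_apply]
    simp

end
end

section
/- The map T_0' : B_c → B_c determined by T_0'(B_0) = B_0 and T_0'(B_1) = (1/(q²[2]_q c))(B_0²B_1 − q[2]_q B_0B_1B_0 + q²B_1B_0²) + B_1 is a two-sided inverse of the algebra endomorphism T_0 given by T_0(B_0)=B_0, T_0(B_1) = (1/(q²[2]_q c))(B_1B_0² − q[2]_q B_0B_1B_0 + q²B_0²B_1) + B_1; in particular T_0(T_0'(B_1)) = B_1 = T_0'(T_0(B_1)). -/
set_option synthInstance.maxHeartbeats 1000000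
set_option maxHeartbeats 1000000

noncomputable section

open scoped BigOperators

theorem aux_inv {K A : Type*} [Field K] [Ring A] [Algebra K A] (q a r s : K) (x y : A)
    (hq : q ≠ 0) (ha : a * (q ^ 2 * r * s) = 1) (hr : q * r = q ^ 2 + 1)
    (h : x ^ 3 * y - (q ^ 2 + 1 + (q⁻¹) ^ 2) • (x ^ 2 * y * x)
        + (q ^ 2 + 1 + (q⁻¹) ^ 2) • (x * y * x ^ 2) - y * x ^ 3
        = (-(q * s * r ^ 2)) • (x * y - y * x)) :
    (a • (x ^ 2 * (a • (y * x ^ 2 - (q * r) • (x * y * x) + q ^ 2 • (x ^ 2 * y)) + y)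
      - (q * r) • (x * (a • (y * x ^ 2 - (q * r) • (x * y * x) + q ^ 2 • (x ^ 2 * y)) + y) * x)
      + q ^ 2 • ((a • (y * x ^ 2 - (q * r) • (x * y * x) + q ^ 2 • (x ^ 2 * y)) + y) * x ^ 2))
      + (a • (y * x ^ 2 - (q * r) • (x * y * x) + q ^ 2 • (x ^ 2 * y)) + y) = y) ∧
    (a • ((a • (x ^ 2 * y - (q * r) • (x * y * x) + q ^ 2 • (y * x ^ 2)) + y) * x ^ 2
      - (q * r) • (x * (a • (x ^ 2 * y - (q * r) • (x * y * x) + q ^ 2 • (y * x ^ 2)) + y) * x)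
      + q ^ 2 • (x ^ 2 * (a • (x ^ 2 * y - (q * r) • (x * y * x) + q ^ 2 • (y * x ^ 2)) + y)))
      + (a • (x ^ 2 * y - (q * r) • (x * y * x) + q ^ 2 • (y * x ^ 2)) + y) = y) := by
  have hs : s * a * q * (q ^ 2 + 1) = 1 := by rw [← hr, ← ha]; ring
  obtain rfl : r = (q ^ 2 + 1) / q := by field_simp; linear_combination hr
  have ha0 : a ≠ 0 := by rintro rfl; simp at hs
  have hq1 : q ^ 2 + 1 ≠ 0 := by intro h0; simp [h0] at hs
  obtain rfl : s = (a * q * (q ^ 2 + 1))⁻¹ := by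
    apply eq_inv_of_mul_eq_one_left; linear_combination hs
  have e1 := congrArg (fun z => x * z) h
  have e2 := congrArg (fun z => z * x) h
  simp only [mul_add, add_mul, mul_sub, sub_mul, smul_add, smul_sub, mul_smul_comm,
    smul_mul_assoc, pow_succ, pow_zero, one_mul, mul_assoc] at e1 e2 ⊢
  constructor <;>
  · linear_combination (norm := skip) (a ^ 2 * q ^ 2) • e1 - (a ^ 2 * q ^ 2) • e2
    match_scalars <;> field_simp <;> ring

theorem QOns_hom_ext (c : KK) (f : QOns c →ₐ[KK] QOns c) (h0 : f (Bo c) = Bo c)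
    (h1 : f (Bi c) = Bi c) : f = AlgHom.id KK (QOns c) := by
  apply RingQuot.ringQuot_ext'
  apply FreeAlgebra.hom_ext
  funext i
  fin_cases i
  · exact h0
  · exact h1

theorem QOns_rel (c : KK) :
    Bo c ^ 3 * Bi c - (qq ^ 2 + 1 + (qq⁻¹) ^ 2) • (Bo c ^ 2 * Bi c * Bo c)
        + (qq ^ 2 + 1 + (qq⁻¹) ^ 2) • (Bo c * Bi c * Bo c ^ 2) - Bi c * Bo c ^ 3
        = (-(qq * c * (qq + qq⁻¹) ^ 2)) • (Bo c * Bi c - Bi c * Bo c) := by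
  have h := RingQuot.mkAlgHom_rel KK (qOnsRel.r0 (c := c))
  simp only [map_add, map_sub, map_mul, map_pow, map_smul] at h
  exact h

theorem qq_ne : qq ≠ 0 := RatFunc.X_ne_zero

theorem qq_sq_ne : qq ^ 2 + 1 ≠ 0 := by
  have h : (Polynomial.X ^ 2 + 1 : Polynomial ℚ) ≠ 0 := by
    intro h
    have := congrArg (Polynomial.eval 0) h
    simp at this
  have h2 := (RatFunc.algebraMap_ne_zero h)
  simpa [qq] using h2

/-- `T₀'` is a two-sided inverse of `T₀`. -/
theorem stmt5 (c : KK) (hc : c ≠ 0) (T0 T0' : QOns c →ₐ[KK] QOns c)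
    (hT00 : T0 (Bo c) = Bo c) (hT01 : T0 (Bi c) = T0B1val c)
    (hT00' : T0' (Bo c) = Bo c) (hT01' : T0' (Bi c) = T0invB1val c) :
    T0.comp T0' = AlgHom.id KK (QOns c) ∧ T0'.comp T0 = AlgHom.id KK (QOns c) := by
  have hq := qq_ne
  have hq1 := qq_sq_ne
  have hr : qq * (qq + qq⁻¹) = qq ^ 2 + 1 := by field_simp
  have hr0 : qq + qq⁻¹ ≠ 0 := by
    intro h0
    rw [h0, mul_zero] at hr
    exact hq1 hr.symm
  have ha : (qq ^ 2 * (qq + qq⁻¹) * c)⁻¹ * (qq ^ 2 * (qq + qq⁻¹) * c) = 1 :=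
    inv_mul_cancel₀ (mul_ne_zero (mul_ne_zero (pow_ne_zero 2 hq) hr0) hc)
  obtain ⟨h1, h2⟩ := aux_inv qq _ (qq + qq⁻¹) c (Bo c) (Bi c) hq ha hr (QOns_rel c)
  constructor
  · apply QOns_hom_ext
    · rw [AlgHom.comp_apply, hT00', hT00]
    · rw [AlgHom.comp_apply, hT01', T0invB1val]
      simp only [map_add, map_sub, map_mul, map_pow, map_smul, hT00, hT01]
      exact h1
  · apply QOns_hom_ext
    · rw [AlgHom.comp_apply, hT00, hT00']
    · rw [AlgHom.comp_apply, hT01, T0B1val]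
      simp only [map_add, map_sub, map_mul, map_pow, map_smul, hT00', hT01']
      exact h2

end
end

section
/- Let n ∈ ℕ and assume T_0Φ(B_{kδ}) = B_{kδ} for all k ≤ n and [B_δ, B_{kδ}] = 0 for all k < n. Then [B_{nδ}, B_δ] = c[2]_q (id − T_0Φ)(B_{(n+1)δ}) in the q-Onsager algebra B_c. -/
set_option synthInstance.maxHeartbeats 1000000
set_option maxHeartbeats 1000000

noncomputable section

open scoped BigOperators

section helper

variable {F R : Type} [Field F] [Ring R] [Algebra F R]

/-- Convolution sums of a bi-infinite sequence. -/
def SS (x : ℤ → R) (a : ℤ) (l : ℕ) : R :=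
  ∑ i ∈ Finset.range l, x (a + i) * x (a + l - 1 - i)

/-- Imaginary root vectors built from a bi-infinite sequence. -/
def BB (p : F) (x : ℤ → R) (a : ℤ) (l : ℕ) : R :=
  -(x (a - 1) * x (a + l)) + p • (x (a + l) * x (a - 1)) + (p - 1) • SS x a l

/-- the two end terms split off -/
lemma SS_two (x : ℤ → R) (a : ℤ) (m : ℕ) :
    SS x a (m + 2) = x a * x (a + m + 1) + x (a + m + 1) * x a + SS x (a + 1) m := by
  unfold SS
  rw [Finset.sum_range_succ, Finset.sum_range_succ']
  have h : ∀ i ∈ Finset.range m, x (a + ((i + 1 : ℕ) : ℤ)) * x (a + ((m + 2 : ℕ) : ℤ) - 1 - ((i + 1 : ℕ) : ℤ))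
      = x (a + 1 + i) * x (a + 1 + m - 1 - i) := by
    intro i _
    congr 2 <;> push_cast <;> ring
  rw [Finset.sum_congr rfl h]
  have e1 : a + ((m + 2 : ℕ) : ℤ) - 1 - ((0 : ℕ) : ℤ) = a + m + 1 := by push_cast; ring
  have e2 : a + ((m + 1 : ℕ) : ℤ) = a + m + 1 := by push_cast; ring
  have e3 : a + ((m + 2 : ℕ) : ℤ) - 1 - ((m + 1 : ℕ) : ℤ) = a := by push_cast; ring
  have e4 : a + ((0 : ℕ) : ℤ) = a := by simp
  rw [e1, e2, e3, e4]
  abel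

lemma map_SS (ψ : R ≃ₐ[F] R) (x : ℤ → R) (hψ : ∀ k, ψ (x k) = x (k - 1)) (a : ℤ) (l : ℕ) :
    ψ (SS x a l) = SS x (a - 1) l := by
  unfold SS
  rw [map_sum]
  refine Finset.sum_congr rfl fun i _ => ?_
  rw [map_mul, hψ, hψ]
  congr 2 <;> ring

lemma map_BB (p : F) (ψ : R ≃ₐ[F] R) (x : ℤ → R) (hψ : ∀ k, ψ (x k) = x (k - 1)) (a : ℤ) (l : ℕ) :
    ψ (BB p x a l) = BB p x (a - 1) l := by
  unfold BB
  have e : a + l - 1 = a - 1 + l := by ring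
  simp only [map_add, map_neg, map_smul, map_mul, hψ, map_SS ψ x hψ, e]

lemma comm_mul (e : F) (D : R) (x : ℤ → R)
    (hD : ∀ k, x k * D - D * x k = e • (x (k + 1) - x (k - 1))) (i j : ℤ) :
    x i * x j * D - D * (x i * x j) =
      e • (x (i + 1) * x j - x (i - 1) * x j + x i * x (j + 1) - x i * x (j - 1)) := by
  have h : x i * x j * D - D * (x i * x j) =
      x i * (x j * D - D * x j) + (x i * D - D * x i) * x j := by noncomm_ring
  rw [h, hD, hD, mul_smul_comm, smul_mul_assoc, ← smul_add]
  congr 1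
  noncomm_ring

lemma comm_SS (e : F) (D : R) (x : ℤ → R)
    (hD : ∀ k, x k * D - D * x k = e • (x (k + 1) - x (k - 1))) (m : ℕ) :
    SS x 0 (m + 1) * D - D * SS x 0 (m + 1) =
      e • (SS x 0 (m + 2) + SS x 0 (m + 2) - x 0 * x (m + 1) - x (m + 1) * x 0
        - SS x 0 m - SS x 0 m - x (-1) * x m - x m * x (-1)) := by
  have h : SS x 0 (m + 1) * D - D * SS x 0 (m + 1) = e • (
      ∑ i ∈ Finset.range (m + 1), x ((i + 1 : ℕ)) * x (m - i)
      - ∑ i ∈ Finset.range (m + 1), x (i - 1) * x (m - i)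
      + ∑ i ∈ Finset.range (m + 1), x i * x (m - i + 1)
      - ∑ i ∈ Finset.range (m + 1), x i * x (m - i - 1)) := by
    rw [← Finset.sum_sub_distrib, ← Finset.sum_add_distrib, ← Finset.sum_sub_distrib,
      Finset.smul_sum]
    unfold SS
    rw [Finset.sum_mul, Finset.mul_sum, ← Finset.sum_sub_distrib]
    refine Finset.sum_congr rfl fun i _ => ?_
    have e1 : (0 : ℤ) + ((m + 1 : ℕ) : ℤ) - 1 - i = m - i := by push_cast; ring
    rw [e1, comm_mul e D x hD, zero_add]
    push_cast
    rfl
  rw [h]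
  have h1 : SS x 0 (m + 2) = ∑ i ∈ Finset.range (m + 1), x ((i + 1 : ℕ)) * x (m - i)
      + x 0 * x (m + 1) := by
    unfold SS
    rw [Finset.sum_range_succ']
    congr 1
    · refine Finset.sum_congr rfl fun i _ => ?_
      congr 2 <;> push_cast <;> ring
    · congr 2; push_cast; ring
  have h2 : SS x 0 (m + 2) = ∑ i ∈ Finset.range (m + 1), x i * x (m - i + 1)
      + x (m + 1) * x 0 := by
    unfold SS
    rw [Finset.sum_range_succ]
    congr 1
    · refine Finset.sum_congr rfl fun i _ => ?_
      congr 2 <;> push_cast <;> ring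
    · congr 2 <;> push_cast <;> ring
  have h3 : ∑ i ∈ Finset.range (m + 1), x (i - 1) * x (m - i) = SS x 0 m + x (-1) * x m := by
    unfold SS
    rw [Finset.sum_range_succ']
    congr 1
    · refine Finset.sum_congr rfl fun i _ => ?_
      congr 2 <;> push_cast <;> ring
  have h4 : ∑ i ∈ Finset.range (m + 1), x i * x (m - i - 1) = SS x 0 m + x m * x (-1) := by
    unfold SS
    rw [Finset.sum_range_succ]
    congr 1
    · refine Finset.sum_congr rfl fun i _ => ?_
      congr 2 <;> push_cast <;> ring
    · congr 2; ring
  rw [h3, h4]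
  congr 1
  have h1' := eq_sub_of_add_eq h1.symm
  have h2' := eq_sub_of_add_eq h2.symm
  rw [h1', h2']
  abel

lemma key_s10 (p e : F) (D : R) (x : ℤ → R) (ψ : R ≃ₐ[F] R) (hψ : ∀ k, ψ (x k) = x (k - 1))
    (hD : ∀ k, x k * D - D * x k = e • (x (k + 1) - x (k - 1))) (n : ℕ)
    (hfix : ∀ k, k + 1 = n → ψ (BB p x 0 k) = BB p x 0 k) :
    BB p x 0 n * D - D * BB p x 0 n = e • (BB p x 0 (n + 1) - ψ (BB p x 0 (n + 1))) := by
  rw [map_BB p ψ x hψ]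
  rcases n with _ | m
  · have h : BB p x 0 0 * D - D * BB p x 0 0 =
      -(x (-1) * x 0 * D - D * (x (-1) * x 0)) + p • (x 0 * x (-1) * D - D * (x 0 * x (-1))) := by
      simp only [BB, SS, Finset.sum_range_zero, add_mul, mul_add, smul_mul_assoc, mul_smul_comm,
        smul_sub, neg_mul, mul_neg, smul_zero, zero_mul, mul_zero]
      norm_num
      abel
    rw [h, comm_mul e D x hD, comm_mul e D x hD]
    simp only [BB, SS]
    norm_num
    module
  · have h : BB p x 0 (m + 1) * D - D * BB p x 0 (m + 1) =
      -(x (-1) * x (m + 1) * D - D * (x (-1) * x (m + 1)))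
      + p • (x (m + 1) * x (-1) * D - D * (x (m + 1) * x (-1)))
      + (p - 1) • (SS x 0 (m + 1) * D - D * SS x 0 (m + 1)) := by
      simp only [BB, add_mul, mul_add, smul_mul_assoc, mul_smul_comm,
        smul_sub, neg_mul, mul_neg, zero_sub, zero_add]
      push_cast
      abel
    have f : BB p x 0 m = BB p x 1 m := by
      apply ψ.injective
      rw [hfix m rfl, map_BB p ψ x hψ]
      norm_num
    rw [h, comm_mul e D x hD, comm_mul e D x hD, comm_SS e D x hD]
    have s1 := SS_two x 0 m
    have s2 := SS_two x (-1) m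
    simp only [BB] at f ⊢
    have e1 : (-1 : ℤ) + m + 1 = m := by ring
    have e2 : (-1 : ℤ) + ((m + 1 + 1 : ℕ) : ℤ) = m + 1 := by push_cast; ring
    have e3 : (m : ℤ) + 1 - 1 = m := by ring
    have e4 : (1 : ℤ) + m = m + 1 := by ring
    have e5 : ((m + 1 + 1 : ℕ) : ℤ) = m + 1 + 1 := by push_cast; ring
    norm_num [e1] at s1 s2
    norm_num [e2, e3, e5]
    norm_num [e4] at f
    rw [s2]
    have f' := congrArg (fun z => e • z) (sub_eq_zero.mpr f)
    rw [smul_zero] at f'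
    rw [← sub_eq_zero, ← neg_eq_zero, ← f', s1]
    module

lemma base_aux (q c : F) (a b : R) (hq : q ≠ 0) (hq2 : q + q⁻¹ ≠ 0) (hc : c ≠ 0) :
    a * (-(a * b) + (q⁻¹ ^ 2) • (b * a)) - (-(a * b) + (q⁻¹ ^ 2) • (b * a)) * a =
      (c * (q + q⁻¹)) • (b - ((q ^ 2 * (q + q⁻¹) * c)⁻¹ •
        (b * a ^ 2 - (q * (q + q⁻¹)) • (a * b * a) + q ^ 2 • (a ^ 2 * b)) + b)) := by
  have e : c * (q + q⁻¹) * (q ^ 2 * (q + q⁻¹) * c)⁻¹ = (q⁻¹) ^ 2 := by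
    generalize q + q⁻¹ = t at hq2
    field_simp
  have e1 : ∀ z : R, b - (z + b) = -z := fun z => by abel
  rw [e1, smul_neg, smul_smul, e]
  have e2 : (q⁻¹) ^ 2 * (q * (q + q⁻¹)) = 1 + (q⁻¹) ^ 2 := by field_simp
  have e3 : (q⁻¹) ^ 2 * q ^ 2 = 1 := by field_simp
  simp only [smul_add, smul_sub, smul_smul, e2, e3]
  simp only [mul_add, add_mul, mul_neg, neg_mul, mul_smul_comm, smul_mul_assoc, pow_two a, mul_assoc]
  module

end helper

/-- Under (AₙI), `[B_{nδ}, B_δ] = c[2]_q (id − T₀Φ)(B_{(n+1)δ})`. -/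
theorem stmt10 (c : KK) (hc : c ≠ 0) (Φ T0 : QOns c ≃ₐ[KK] QOns c)
    (hΦ0 : Φ (Bo c) = Bi c) (hΦ1 : Φ (Bi c) = Bo c)
    (hT00 : T0 (Bo c) = Bo c) (hT01 : T0 (Bi c) = T0B1val c)
    (n : ℕ) (hn : 1 ≤ n)
    (hfix : ∀ k, 1 ≤ k → k ≤ n → T0 (Φ (Bim c Φ T0 (k))) = Bim c Φ T0 (k))
    (hcom : ∀ k, 1 ≤ k → k < n → Bdel c * Bim c Φ T0 (k) - Bim c Φ T0 (k) * Bdel c = 0) :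
    Bim c Φ T0 (n) * Bdel c - Bdel c * Bim c Φ T0 (n) =
      (c * (qq + qq⁻¹)) • (Bim c Φ T0 (n + 1) - T0 (Φ (Bim c Φ T0 (n + 1)))) := by
  classical
  set ψ : QOns c ≃ₐ[KK] QOns c := T0 * Φ with hψdef
  have hψa : ∀ y, ψ y = T0 (Φ y) := fun y => rfl
  set x : ℤ → QOns c := fun k => (ψ ^ (-k)) (Bi c) with hx
  have hψ : ∀ k, ψ (x k) = x (k - 1) := by
    intro k
    simp only [hx]
    rw [← AlgEquiv.mul_apply, ← zpow_one_add]
    congr 2; ring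
  have x0 : x 0 = Bi c := by
    simp only [hx, neg_zero, zpow_zero]
    rfl
  have x1 : x (-1) = Bo c := by
    have := hψ 0
    rw [x0, hψa, hΦ1, hT00] at this
    simpa using this.symm
  have x2 : x (-2) = T0B1val c := by
    have := hψ (-1)
    rw [x1, hψa, hΦ0, hT01] at this
    simpa using this.symm
  have hBa : ∀ k : ℕ, Ba1 c Φ T0 k = x k := by
    intro k
    induction k with
    | zero => simpa [Ba1] using x0.symm
    | succ k ih =>
      unfold Ba1 at ih ⊢
      rw [Function.iterate_succ_apply', ih]
      apply ψ.injective
      rw [hψ, hψa]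
      have : ((k + 1 : ℕ) : ℤ) - 1 = k := by push_cast; ring
      rw [this]
      have h2 : (T1def c Φ T0) ((T1def c Φ T0).symm (Φ (x k))) = Φ (x k) :=
        AlgEquiv.apply_symm_apply _ _
      have h3 : Φ (T0 (Φ ((T1def c Φ T0).symm (Φ (x k))))) = Φ (x k) := h2
      exact Φ.injective h3
  have hB : ∀ l : ℕ, Bim c Φ T0 (l + 1) = BB (qq⁻¹ ^ 2) x 0 l := by
    intro l
    unfold Bim BB CC SS
    simp only [hBa, Nat.add_sub_cancel, zero_sub, zero_add, x1]
    congr 2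
    refine Finset.sum_congr rfl fun i hi => ?_
    have := Finset.mem_range.mp hi
    congr 2
    omega
  have hD1 : Bim c Φ T0 1 = Bdel c := by
    simp [Bim, CC, Bdel, hBa, x0]
  have hψD : ψ (Bdel c) = Bdel c := by
    rw [← hD1]; exact hfix 1 le_rfl hn
  have hq : qq ≠ 0 := RatFunc.X_ne_zero
  have hq2 : qq + qq⁻¹ ≠ 0 := by
    intro h
    have h1 : qq ^ 2 + 1 = 0 := by
      have := congrArg (fun z => z * qq) h
      simp only [add_mul, inv_mul_cancel₀ hq, zero_mul] at this
      rw [pow_two]; exact this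
    have h2 : (algebraMap (Polynomial ℚ) KK) (Polynomial.X ^ 2 + 1) = 0 := by
      simpa [qq] using h1
    have h3 : (Polynomial.X ^ 2 + 1 : Polynomial ℚ) = 0 :=
      (RatFunc.algebraMap_injective ℚ) (by rw [h2, map_zero])
    have h4 := congrArg (Polynomial.eval 0) h3
    norm_num at h4
  have base : x (-1) * Bdel c - Bdel c * x (-1) =
      (c * (qq + qq⁻¹)) • (x 0 - x (-2)) := by
    rw [x2, x1, x0]
    unfold Bdel T0B1val
    generalize Bo c = a
    generalize Bi c = b
    exact base_aux qq c a b hq hq2 hc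
  have up : ∀ k, (x k * Bdel c - Bdel c * x k = (c * (qq + qq⁻¹)) • (x (k + 1) - x (k - 1))) ↔
      (x (k - 1) * Bdel c - Bdel c * x (k - 1) =
        (c * (qq + qq⁻¹)) • (x (k - 1 + 1) - x (k - 1 - 1))) := by
    intro k
    rw [← ψ.injective.eq_iff]
    simp only [map_sub, map_mul, map_smul, hψ, hψD]
    rw [show k + 1 - 1 = k - 1 + 1 by ring]
  have hD : ∀ k, x k * Bdel c - Bdel c * x k = (c * (qq + qq⁻¹)) • (x (k + 1) - x (k - 1)) := by
    intro k
    induction k using Int.induction_on with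
    | zero => exact (up 0).mpr (by simpa using base)
    | succ i ih => exact (up _).mpr (by simpa using ih)
    | pred i ih => exact (up _).mp ih
  obtain ⟨l, rfl⟩ : ∃ l, n = l + 1 := ⟨n - 1, by omega⟩
  rw [← hψa, hB, hB]
  refine key_s10 (qq⁻¹ ^ 2) (c * (qq + qq⁻¹)) (Bdel c) x ψ hψ hD l ?_
  intro k hk
  rw [← hB]
  exact hfix (k + 1) (by omega) (by omega)

end
end
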